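/- arXiv:2512.06047 — 4 statements merged into one kernel-verified Lean document; each statement's English description precedes it below -/
import Mathlib

section
/- Suppose f : ℕ → M satisfies the Volterra-type recurrence f(n) = g(n) + Σ_{p=1}^{n-1} w(p,n) • f(p) for every n ≥ 1. Then for every n ≥ 1 one has the compact representation f(n) = Σ_{p=1}^{n} ψ(p,n) • g(p), where ψ are the path-sum coefficients. -/
/-- Let `R` be a commutative ring, `M` an `R`-module, `w` a family of
weights and `g : ℕ → M`.  If `f` satisfies the Volterra-type recurrence
`f n = g n + ∑_{p=1}^{n-1} w p n • f p` for every `n ≥ 1`, and `ψ` are the path-sum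
coefficients (characterized by `ψ n n = 1` and
`ψ p n = ∑_{q=p}^{n-1} ψ p q * w q n` for `p < n`), then for every `n ≥ 1` one has the
compact representation `f n = ∑_{p=1}^{n} ψ p n • g p`. -/
theorem volterra_recurrence_compact_representation
    {R : Type*} [CommRing R] {M : Type*} [AddCommGroup M] [Module R M]
    (w : ℕ → ℕ → R) (g : ℕ → M) (f : ℕ → M) (ψ : ℕ → ℕ → R)
    (hψ_diag : ∀ n : ℕ, ψ n n = 1)
    (hψ_rec : ∀ p n : ℕ, p < n → ψ p n = ∑ q ∈ Finset.Ico p n, ψ p q * w q n)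
    (hf : ∀ n : ℕ, 1 ≤ n → f n = g n + ∑ p ∈ Finset.Ico 1 n, w p n • f p) :
    ∀ n : ℕ, 1 ≤ n → f n = ∑ p ∈ Finset.Icc 1 n, ψ p n • g p := by
  intro n
  induction n using Nat.strong_induction_on with
  | _ n ih =>
    intro hn
    rw [hf n hn, ← Finset.Ico_insert_right hn, Finset.sum_insert Finset.right_notMem_Ico,
      hψ_diag, one_smul]
    congr 1
    calc ∑ q ∈ Finset.Ico 1 n, w q n • f q
        = ∑ q ∈ Finset.Ico 1 n, ∑ p ∈ Finset.Icc 1 q, (ψ p q * w q n) • g p := by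
          refine Finset.sum_congr rfl fun q hq => ?_
          rw [Finset.mem_Ico] at hq
          rw [ih q hq.2 hq.1, Finset.smul_sum]
          exact Finset.sum_congr rfl fun p _ => by rw [smul_smul, mul_comm]
      _ = ∑ p ∈ Finset.Ico 1 n, ∑ q ∈ Finset.Ico p n, (ψ p q * w q n) • g p :=
          Finset.sum_comm' fun q p => by
            simp only [Finset.mem_Ico, Finset.mem_Icc]
            omega
      _ = ∑ p ∈ Finset.Ico 1 n, ψ p n • g p := by
          refine Finset.sum_congr rfl fun p hp => ?_
          rw [hψ_rec p n (Finset.mem_Ico.mp hp).2, Finset.sum_smul]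
end

section
/- Conversely, if f : ℕ → M is defined by f(n) = Σ_{p=1}^{n} ψ(p,n) • g(p) for every n ≥ 1, then f satisfies the Volterra-type recurrence f(n) = g(n) + Σ_{p=1}^{n-1} w(p,n) • f(p) for every n ≥ 1. -/
/-- Conversely, if `f : ℕ → M` is defined by
`f n = ∑_{p=1}^{n} ψ p n • g p` for every `n ≥ 1`, where `ψ` are the path-sum
coefficients (characterized by `ψ n n = 1` and
`ψ p n = ∑_{q=p}^{n-1} ψ p q * w q n` for `p < n`), then `f` satisfies the
Volterra-type recurrence `f n = g n + ∑_{p=1}^{n-1} w p n • f p` for every `n ≥ 1`. -/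
theorem compact_representation_volterra_recurrence
    {R : Type*} [CommRing R] {M : Type*} [AddCommGroup M] [Module R M]
    (w : ℕ → ℕ → R) (g : ℕ → M) (f : ℕ → M) (ψ : ℕ → ℕ → R)
    (hψ_diag : ∀ n : ℕ, ψ n n = 1)
    (hψ_rec : ∀ p n : ℕ, p < n → ψ p n = ∑ q ∈ Finset.Ico p n, ψ p q * w q n)
    (hf : ∀ n : ℕ, 1 ≤ n → f n = ∑ p ∈ Finset.Icc 1 n, ψ p n • g p) :
    ∀ n : ℕ, 1 ≤ n → f n = g n + ∑ p ∈ Finset.Ico 1 n, w p n • f p := by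
  intro n hn
  rw [hf n hn, ← Finset.Ico_insert_right hn, Finset.sum_insert Finset.right_notMem_Ico,
    hψ_diag, one_smul]
  congr 1
  calc ∑ p ∈ Finset.Ico 1 n, ψ p n • g p
      = ∑ p ∈ Finset.Ico 1 n, ∑ q ∈ Finset.Ico p n, (ψ p q * w q n) • g p := by
        refine Finset.sum_congr rfl fun p hp => ?_
        rw [hψ_rec p n (Finset.mem_Ico.mp hp).2, Finset.sum_smul]
    _ = ∑ q ∈ Finset.Ico 1 n, ∑ p ∈ Finset.Icc 1 q, (ψ p q * w q n) • g p := by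
        refine Finset.sum_comm' fun p q => ?_
        simp only [Finset.mem_Ico, Finset.mem_Icc]
        omega
    _ = ∑ q ∈ Finset.Ico 1 n, w q n • f q := by
        refine Finset.sum_congr rfl fun q hq => ?_
        rw [hf q (Finset.mem_Ico.mp hq).1, Finset.smul_sum]
        exact Finset.sum_congr rfl fun p _ => by rw [smul_smul, mul_comm]
end

section
/- Suppose f : ℕ → M satisfies the Volterra-type recurrence f(n) = g(n) + Σ_{p=1}^{n-1} w(p,n) • f(p) for every n ≥ 1. Then for every n ≥ 1, f(n) = g(n) + Σ_{p=1}^{n-1} ( Σ_{P ∈ 𝒫(p,n)} ∏_{(i,j) ∈ P} w(i,j) ) • g(p), where 𝒫(p,n) is the set of all chains from p to n. -/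
/-- The weight of a chain `i₀ :: i₁ :: ⋯ :: iₘ`, namely the product
`∏_{j=0}^{m-1} w iⱼ i_{j+1}` of the weights of its consecutive pairs. -/
def chainWeight {R : Type*} [CommRing R] (w : ℕ → ℕ → R) : List ℕ → R
  | i :: j :: rest => w i j * chainWeight w (j :: rest)
  | _ => 1

/-- The (finite) set of all chains from `p` to `n`: finite strictly increasing sequences
`p = i₀ < i₁ < ⋯ < iₘ = n` (with `m ≥ 1` steps, assuming `p < n`).  Such a chain is
uniquely determined by its set of intermediate vertices, a subset of the open interval
`(p, n)`, listed in increasing order. -/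
def chains (p n : ℕ) : Finset (List ℕ) :=
  (Finset.Ioo p n).powerset.image (fun S => p :: (S.sort (· ≤ ·) ++ [n]))

theorem Finset.sort_insert_of_forall_lt {α : Type*} [LinearOrder α] {s : Finset α} {a : α}
    (h : ∀ b ∈ s, b < a) : (insert a s).sort (· ≤ ·) = s.sort (· ≤ ·) ++ [a] := by
  have hnd : (s.sort (· ≤ ·) ++ [a]).Nodup := by
    refine (Finset.sort_nodup s _).append (List.nodup_singleton a) ?_
    simpa using fun ha => (h a ha).false
  have hset : (s.sort (· ≤ ·) ++ [a]).toFinset = insert a s := by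
    ext b
    simp
  rw [← hset, List.toFinset_sort _ hnd, List.pairwise_append]
  refine ⟨Finset.pairwise_sort s _, List.pairwise_singleton _ _, fun b hb c hc => ?_⟩
  rw [List.mem_singleton.1 hc]
  exact (h b ((Finset.mem_sort _).1 hb)).le

/-- Sorting the subsets of an open interval by their largest element. -/
theorem Finset.sum_powerset_Ioo {A : Type*} [AddCommMonoid A] (F : Finset ℕ → A) {p n : ℕ}
    (h : p < n) :
    ∑ S ∈ (Finset.Ioo p n).powerset, F S =
      F ∅ + ∑ q ∈ Finset.Ico (p + 1) n, ∑ S ∈ (Finset.Ioo p q).powerset, F (insert q S) := by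
  induction n, h using Nat.le_induction with
  | base =>
    have : Finset.Ioo p p.succ = ∅ := by
      ext
      simp
    simp [this]
  | succ n hn ih =>
    have hins : Finset.Ioo p (n + 1) = insert n (Finset.Ioo p n) := by
      ext
      simp
      omega
    rw [hins, Finset.sum_powerset_insert Finset.right_notMem_Ioo, ih,
      Finset.sum_Ico_succ_top hn, add_assoc]

section ChainWeight

variable {R : Type*} [CommRing R] (w : ℕ → ℕ → R)

@[simp]
theorem chainWeight_pair (i j : ℕ) : chainWeight w [i, j] = w i j := by
  simp [chainWeight]

theorem chainWeight_cons_append_pair (l : List ℕ) (i q n : ℕ) :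
    chainWeight w (i :: (l ++ [q] ++ [n])) = chainWeight w (i :: (l ++ [q])) * w q n := by
  induction l generalizing i with
  | nil => simp [chainWeight]
  | cons j l ih =>
    have h := ih j
    simp only [List.cons_append] at h ⊢
    simp only [chainWeight, h, mul_assoc]

theorem sum_chains (p n : ℕ) :
    ∑ l ∈ chains p n, chainWeight w l =
      ∑ S ∈ (Finset.Ioo p n).powerset, chainWeight w (p :: (S.sort (· ≤ ·) ++ [n])) := by
  refine Finset.sum_image fun S _ T _ hST => ?_
  have hsort : S.sort (· ≤ ·) = T.sort (· ≤ ·) := by simpa using hST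
  simpa using congrArg List.toFinset hsort

/-- Decomposition of the chains from `p` to `n` according to their last step. -/
theorem sum_chains_eq_add_sum {p n : ℕ} (h : p < n) :
    ∑ l ∈ chains p n, chainWeight w l =
      w p n + ∑ q ∈ Finset.Ico (p + 1) n, (∑ l ∈ chains p q, chainWeight w l) * w q n := by
  rw [sum_chains, Finset.sum_powerset_Ioo _ h]
  congr 1
  · simp
  · refine Finset.sum_congr rfl fun q _ => ?_
    rw [sum_chains, Finset.sum_mul]
    refine Finset.sum_congr rfl fun S hS => ?_
    rw [Finset.sort_insert_of_forall_lt fun b hb =>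
      (Finset.mem_Ioo.1 (Finset.mem_powerset.1 hS hb)).2, chainWeight_cons_append_pair]

end ChainWeight

/-- If `f : ℕ → M` satisfies the Volterra-type recurrence
`f n = g n + ∑_{p=1}^{n-1} w p n • f p` for every `n ≥ 1`, then for every `n ≥ 1`,
`f n = g n + ∑_{p=1}^{n-1} (∑_{P ∈ 𝒫(p,n)} ∏_{(i,j) ∈ P} w i j) • g p`, where
`𝒫(p,n)` is the set of all chains from `p` to `n`. -/
theorem volterra_recurrence_chain_sum_representation
    {R : Type*} [CommRing R] {M : Type*} [AddCommGroup M] [Module R M]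
    (w : ℕ → ℕ → R) (g : ℕ → M) (f : ℕ → M)
    (hf : ∀ n : ℕ, 1 ≤ n → f n = g n + ∑ p ∈ Finset.Ico 1 n, w p n • f p) :
    ∀ n : ℕ, 1 ≤ n →
      f n = g n + ∑ p ∈ Finset.Ico 1 n, (∑ l ∈ chains p n, chainWeight w l) • g p := by
  intro n
  induction n using Nat.strong_induction_on with
  | _ n ih =>
    intro hn
    have hstep : ∑ q ∈ Finset.Ico 1 n, w q n • f q =
        ∑ q ∈ Finset.Ico 1 n, w q n • g q + ∑ q ∈ Finset.Ico 1 n, ∑ p ∈ Finset.Ico 1 q,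
          ((∑ l ∈ chains p q, chainWeight w l) * w q n) • g p := by
      rw [← Finset.sum_add_distrib]
      refine Finset.sum_congr rfl fun q hq => ?_
      rw [Finset.mem_Ico] at hq
      rw [ih q hq.2 hq.1, smul_add, Finset.smul_sum]
      simp only [smul_smul, mul_comm]
    rw [hf n hn, hstep, ← Finset.sum_Ico_Ico_comm', ← Finset.sum_add_distrib]
    refine congrArg _ (Finset.sum_congr rfl fun p hp => ?_)
    rw [sum_chains_eq_add_sum w (Finset.mem_Ico.1 hp).2, add_smul, Finset.sum_smul]
end

section
/- Let V be a real Banach space, τ > 0, ν ∈ ℝ, n ≥ 1 a natural number, and x_0, …, x_n, y_0, …, y_n ∈ V. If the Bochner integral ∫_0^τ ( Σ_{p=1}^{n} p t^{p-1} • x_p − ν Σ_{p=0}^{n} t^p • y_p ) · t^n dt = 0, then n • x_n − ν • y_{n-1} − (2nντ / (2n+1)) • y_n + Σ_{p=1}^{n-1} ( 2n / ((p+n) τ^{n-p}) ) • ( p • x_p − ν • y_{p-1} ) = 0. -/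
/-- Term-by-term integration of a vector-valued polynomial. -/
theorem intervalIntegral_sum_pow_smul {V ι : Type*} [NormedAddCommGroup V] [NormedSpace ℝ V]
    [CompleteSpace V] (s : Finset ι) (k : ι → ℕ) (v : ι → V) (τ : ℝ) :
    ∫ t in (0 : ℝ)..τ, ∑ i ∈ s, t ^ k i • v i =
      ∑ i ∈ s, (τ ^ (k i + 1) / ((k i : ℝ) + 1)) • v i := by
  rw [intervalIntegral.integral_finsetSum fun i _ =>
    (by fun_prop : Continuous fun t : ℝ => t ^ k i • v i).intervalIntegrable _ _]
  refine Finset.sum_congr rfl fun i _ => ?_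
  simp [intervalIntegral.integral_smul_const, integral_pow]

/-- The residual of the truncated expansion, multiplied by `t ^ n` and collected in powers
of `t`. -/
theorem pow_smul_residual_eq {V : Type*} [AddCommGroup V] [Module ℝ V]
    (ν t : ℝ) (n : ℕ) (x y : ℕ → V) :
    t ^ n • ((∑ p ∈ Finset.Icc 1 n, ((p : ℝ) * t ^ (p - 1)) • x p) -
        ν • ∑ p ∈ Finset.range (n + 1), t ^ p • y p) =
      ∑ p ∈ Finset.range (n + 1), t ^ (p + n) •
        ((if p < n then ((p + 1 : ℕ) : ℝ) • x (p + 1) else 0) - ν • y p) := by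
  have hx : ∑ p ∈ Finset.Icc 1 n, ((p : ℝ) * t ^ (p - 1)) • x p =
      ∑ p ∈ Finset.range n, (((p + 1 : ℕ) : ℝ) * t ^ p) • x (p + 1) := by
    rw [← Finset.Ico_add_one_right_eq_Icc, Finset.sum_Ico_eq_sum_range]
    simp [add_comm]
  have hif : ∑ p ∈ Finset.range n, (((p + 1 : ℕ) : ℝ) * t ^ p) • x (p + 1) =
      ∑ p ∈ Finset.range (n + 1), t ^ p •
        (if p < n then ((p + 1 : ℕ) : ℝ) • x (p + 1) else 0) := by
    rw [Finset.sum_range_succ]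
    simp only [lt_irrefl, if_false, smul_zero, add_zero]
    refine Finset.sum_congr rfl fun p hp => ?_
    rw [if_pos (Finset.mem_range.mp hp), smul_smul, mul_comm]
  rw [hx, hif, Finset.smul_sum, ← Finset.sum_sub_distrib, Finset.smul_sum]
  refine Finset.sum_congr rfl fun p _ => ?_
  rw [pow_add]
  module

/-- Let `V` be a real Banach space, `τ > 0`, `ν ∈ ℝ`, `n ≥ 1` a
natural number, and `x 0, …, x n, y 0, …, y n ∈ V`.  If the Bochner integral
`∫_0^τ (∑_{p=1}^{n} p t^{p-1} • x p − ν • ∑_{p=0}^{n} t^p • y p) · t^n dt = 0`, then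
`n • x n − ν • y (n-1) − (2nντ/(2n+1)) • y n
  + ∑_{p=1}^{n-1} (2n/((p+n) τ^{n-p})) • (p • x p − ν • y (p-1)) = 0`. -/
theorem spgd_space_mode_equation_diffusion
    {V : Type*} [NormedAddCommGroup V] [NormedSpace ℝ V] [CompleteSpace V]
    (τ : ℝ) (hτ : 0 < τ) (ν : ℝ) (n : ℕ) (hn : 1 ≤ n) (x y : ℕ → V)
    (hint : (∫ t in (0 : ℝ)..τ,
        t ^ n • ((∑ p ∈ Finset.Icc 1 n, ((p : ℝ) * t ^ (p - 1)) • x p) -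
          ν • ∑ p ∈ Finset.range (n + 1), t ^ p • y p)) = 0) :
    (n : ℝ) • x n - ν • y (n - 1) -
        ((2 * (n : ℝ) * ν * τ) / (2 * (n : ℝ) + 1)) • y n +
        ∑ p ∈ Finset.Ico 1 n,
          ((2 * (n : ℝ)) / (((p : ℝ) + (n : ℝ)) * τ ^ (n - p))) •
            ((p : ℝ) • x p - ν • y (p - 1)) = 0 := by
  obtain ⟨m, rfl⟩ : ∃ m, n = m + 1 := ⟨n - 1, by omega⟩
  simp only [pow_smul_residual_eq] at hint
  rw [intervalIntegral_sum_pow_smul] at hint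
  have h := congrArg
    (fun w => ((2 * ((m + 1 : ℕ) : ℝ)) / τ ^ (2 * (m + 1))) • w) hint
  simp only [smul_zero] at h
  rw [← h, Finset.smul_sum, Finset.sum_range_succ, Finset.sum_range_succ,
    Finset.sum_Ico_eq_sum_range]
  have hlow : ∀ p ∈ Finset.range m,
      ((2 * ((m + 1 : ℕ) : ℝ)) / (((1 + p : ℕ) + ((m + 1 : ℕ) : ℝ)) * τ ^ (m + 1 - (1 + p)))) •
        (((1 + p : ℕ) : ℝ) • x (1 + p) - ν • y (1 + p - 1)) =
      ((2 * ((m + 1 : ℕ) : ℝ)) / τ ^ (2 * (m + 1))) •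
        (τ ^ (p + (m + 1) + 1) / (((p + (m + 1) : ℕ) : ℝ) + 1)) •
          ((if p < m + 1 then ((p + 1 : ℕ) : ℝ) • x (p + 1) else 0) - ν • y p) := by
    intro p hp
    obtain ⟨d, rfl⟩ := Nat.exists_eq_add_of_lt (Finset.mem_range.mp hp)
    rw [if_pos (by omega), smul_smul, add_comm 1 p, Nat.add_sub_cancel,
      show p + d + 1 + 1 - (p + 1) = d + 1 by omega]
    congr 1
    push_cast
    field_simp
    ring
  simp only [Nat.add_sub_cancel]
  rw [Finset.sum_congr rfl hlow, if_pos (Nat.lt_succ_self m), if_neg (lt_irrefl _)]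
  have hmid : (2 * ((m + 1 : ℕ) : ℝ)) / τ ^ (2 * (m + 1)) *
      (τ ^ (m + (m + 1) + 1) / (((m + (m + 1) : ℕ) : ℝ) + 1)) = 1 := by
    push_cast
    field_simp
    ring
  have htop : (2 * ((m + 1 : ℕ) : ℝ)) / τ ^ (2 * (m + 1)) *
      (τ ^ (m + 1 + (m + 1) + 1) / (((m + 1 + (m + 1) : ℕ) : ℝ) + 1)) * ν =
      (2 * ((m + 1 : ℕ) : ℝ) * ν * τ) / (2 * ((m + 1 : ℕ) : ℝ) + 1) := by
    push_cast
    field_simp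
    ring
  rw [smul_smul _ _ (_ - ν • y m), hmid, one_smul, zero_sub, smul_neg, smul_neg, smul_smul,
    smul_smul, htop]
  abel
end
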